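/- Under the same hypotheses and algorithm as in the main secure-estimation theorem (Theorem 6) — namely: Ã_i H_i = H_i A and C̃_i H_i = C_i for all i; γ ≥ B_w + ‖L_i‖₂ B_v and σ_max(Ã_i − L_i C̃_i) ≤ (γ − B_w − ‖L_i‖₂ B_v)/((2√n_i + 1) γ) for all i; |{ i : j ∈ Q_i }| ≥ 2p + 1 for all j; x(k+1) = A x(k) + w(k) with ‖w(k)‖₂ ≤ B_w; y_i(k) = C_i x(k) + v_i(k) + a_i(k) with |v_i(k)| ≤ B_v and |{ i : a_i(k) ≠ 0 }| ≤ p; ‖x̂(0) − x(0)‖_∞ ≤ γ, η_i⁺(0) = H_i x̂(0); η_i(k) = (Ã_i − L_i C̃_i) η_i⁺(k−1) + L_i y_i(k−1); x̂(k) a global minimizer of z ↦ Σ_i ‖η_i(k) − H_i z‖₁; reset rule η_i⁺(k) = H_i x̂(k) if ‖η_i(k) − H_i x̂(k)‖₂ > (√n_i + 1) γ, else η_i⁺(k) = η_i(k) — the following holds: for every k ≥ 0 and every sensor i with a_i(k) = 0, one has ‖η_i(k+1) − H_i x̂(k+1)‖₂ ≤ (√n_i + 1) γ; that is, a sensor that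 is benign at time k does not trigger the detector at time k+1. -/

import Mathlib

open Matrix

/-- The 1-norm of a real vector. -/
def norm1 {n : ℕ} (x : Fin n → ℝ) : ℝ := ∑ j, |x j|

/-- The Euclidean (2-)norm of a real vector. -/
noncomputable def vnorm2 {n : ℕ} (x : Fin n → ℝ) : ℝ := Real.sqrt (∑ j, (x j) ^ 2)

/-- The induced 2-norm (largest singular value) of a real matrix. -/
noncomputable def mat2Norm {p q : ℕ} (M : Matrix (Fin p) (Fin q) ℝ) : ℝ :=
  ‖LinearMap.toContinuousLinearMap (Matrix.toEuclideanLin M)‖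

/-- The selection matrix of `Q ⊆ {1,…,n}`: its rows are the transposed canonical basis
vectors `e_jᵀ`, `j ∈ Q`, listed in increasing order of `j`. -/
def selMatrix {n d : ℕ} (Q : Finset (Fin n)) (h : Q.card = d) :
    Matrix (Fin d) (Fin n) ℝ :=
  Matrix.of fun k j => if j = (Q.orderIsoOfFin h k : Fin n) then 1 else 0

lemma vnorm2_eq_norm {n : ℕ} (x : Fin n → ℝ) : vnorm2 x = ‖WithLp.toLp 2 x‖ := by
  simp [vnorm2, EuclideanSpace.norm_eq]

lemma vnorm2_nonneg {n : ℕ} (x : Fin n → ℝ) : 0 ≤ vnorm2 x := Real.sqrt_nonneg _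

lemma vnorm2_add_le {n : ℕ} (x y : Fin n → ℝ) : vnorm2 (x + y) ≤ vnorm2 x + vnorm2 y := by
  simpa only [vnorm2_eq_norm, WithLp.toLp_add] using norm_add_le _ _

lemma vnorm2_sub_comm {n : ℕ} (x y : Fin n → ℝ) : vnorm2 (x - y) = vnorm2 (y - x) := by
  simpa only [vnorm2_eq_norm, WithLp.toLp_sub] using norm_sub_rev _ _

lemma vnorm2_sub_le_add {n : ℕ} (x y z : Fin n → ℝ) :
    vnorm2 (x - z) ≤ vnorm2 (x - y) + vnorm2 (y - z) := by
  simpa using vnorm2_add_le (x - y) (y - z)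

lemma vnorm2_smul {n : ℕ} (c : ℝ) (x : Fin n → ℝ) : vnorm2 (c • x) = |c| * vnorm2 x := by
  simp only [vnorm2_eq_norm, WithLp.toLp_smul, norm_smul, Real.norm_eq_abs]

lemma vnorm2_mulVec_le {q r : ℕ} (M : Matrix (Fin q) (Fin r) ℝ) (x : Fin r → ℝ) :
    vnorm2 (M.mulVec x) ≤ mat2Norm M * vnorm2 x := by
  simpa [vnorm2_eq_norm, mat2Norm, Matrix.toLpLin_toLp] using
    (LinearMap.toContinuousLinearMap (Matrix.toEuclideanLin M)).le_opNorm (WithLp.toLp 2 x)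

lemma vnorm2_le_of_abs_le {n : ℕ} {x : Fin n → ℝ} {c : ℝ} (hc : 0 ≤ c) (h : ∀ j, |x j| ≤ c) :
    vnorm2 x ≤ Real.sqrt n * c := by
  have hsum : ∑ j, x j ^ 2 ≤ n * c ^ 2 := by
    calc ∑ j, x j ^ 2 ≤ ∑ _j : Fin n, c ^ 2 :=
          Finset.sum_le_sum fun j _ => sq_le_sq.2 ((h j).trans (le_abs_self c))
      _ = n * c ^ 2 := by simp
  calc vnorm2 x ≤ Real.sqrt (n * c ^ 2) := Real.sqrt_le_sqrt hsum
    _ = Real.sqrt n * c := by rw [Real.sqrt_mul (Nat.cast_nonneg n), Real.sqrt_sq hc]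

lemma abs_le_vnorm2 {n : ℕ} (x : Fin n → ℝ) (j : Fin n) : |x j| ≤ vnorm2 x := by
  rw [vnorm2_eq_norm]
  exact PiLp.norm_apply_le (WithLp.toLp 2 x) j

lemma selMatrix_mulVec {n : ℕ} (Q : Finset (Fin n)) (z : Fin n → ℝ) (k : Fin Q.card) :
    (selMatrix Q rfl).mulVec z k = z (Q.orderIsoOfFin rfl k) := by
  simp only [selMatrix, Matrix.mulVec, dotProduct, Matrix.of_apply, ite_mul, one_mul, zero_mul]
  exact (Finset.sum_ite_eq' _ _ _).trans (if_pos (Finset.mem_univ _))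

lemma sum_orderIsoOfFin {n : ℕ} (Q : Finset (Fin n)) (f : Fin n → ℝ) :
    ∑ k, f (Q.orderIsoOfFin rfl k) = ∑ j ∈ Q, f j := by
  rw [← Finset.sum_coe_sort Q f]
  exact Equiv.sum_comp (Q.orderIsoOfFin rfl).toEquiv fun j : Q => f j

lemma vnorm2_selMatrix_mulVec_le {n : ℕ} (Q : Finset (Fin n)) (z : Fin n → ℝ) :
    vnorm2 ((selMatrix Q rfl).mulVec z) ≤ vnorm2 z := by
  simp only [vnorm2, selMatrix_mulVec]
  rw [sum_orderIsoOfFin Q fun j => z j ^ 2]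
  exact Real.sqrt_le_sqrt
    (Finset.sum_le_sum_of_subset_of_nonneg (Finset.subset_univ Q) fun _ _ _ => sq_nonneg _)

lemma vnorm2_selMatrix_sub_le {n : ℕ} (Q : Finset (Fin n)) {x z : Fin n → ℝ} {c : ℝ}
    (hc : 0 ≤ c) (h : ∀ j, |x j - z j| ≤ c) :
    vnorm2 ((selMatrix Q rfl).mulVec x - (selMatrix Q rfl).mulVec z) ≤ Real.sqrt Q.card * c :=
  vnorm2_le_of_abs_le hc fun k => by simpa only [Pi.sub_apply, selMatrix_mulVec] using h _

/-- The zero extension of a vector indexed by `Q` to all coordinates. -/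
noncomputable def selExtend {n : ℕ} (Q : Finset (Fin n)) (u : Fin Q.card → ℝ) (j : Fin n) : ℝ :=
  if h : j ∈ Q then u ((Q.orderIsoOfFin rfl).symm ⟨j, h⟩) else 0

lemma selExtend_orderIsoOfFin {n : ℕ} (Q : Finset (Fin n)) (u : Fin Q.card → ℝ)
    (k : Fin Q.card) : selExtend Q u (Q.orderIsoOfFin rfl k) = u k := by
  rw [selExtend, dif_pos (Q.orderIsoOfFin rfl k).2, Subtype.coe_eta, OrderIso.symm_apply_apply]

lemma norm1_sub_selMatrix_mulVec {n : ℕ} (Q : Finset (Fin n)) (u : Fin Q.card → ℝ)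
    (z : Fin n → ℝ) :
    norm1 (u - (selMatrix Q rfl).mulVec z) = ∑ j ∈ Q, |selExtend Q u j - z j| := by
  rw [← sum_orderIsoOfFin Q fun j => |selExtend Q u j - z j|]
  simp only [norm1, Pi.sub_apply, selMatrix_mulVec, selExtend_orderIsoOfFin]

lemma abs_selExtend_sub_le {n : ℕ} (Q : Finset (Fin n)) (u : Fin Q.card → ℝ)
    (z : Fin n → ℝ) {j : Fin n} (hj : j ∈ Q) :
    |selExtend Q u j - z j| ≤ vnorm2 (u - (selMatrix Q rfl).mulVec z) := by
  have h := abs_le_vnorm2 (u - (selMatrix Q rfl).mulVec z) ((Q.orderIsoOfFin rfl).symm ⟨j, hj⟩)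
  simpa [selMatrix_mulVec, selExtend, hj] using h

/-- If a strict majority of the points `u i` lie beyond `t` as seen from `b`, then `t` has a
strictly smaller sum of absolute deviations than `b`. -/
lemma not_sum_abs_sub_le_of_majority {ι : Type*} [DecidableEq ι] {N B : Finset ι} {p : ℕ}
    (hN : 2 * p + 1 ≤ N.card) (hB : B.card ≤ p) {u : ι → ℝ} {b t : ℝ} (hbt : b ≠ t)
    (h : ∀ i ∈ N, i ∉ B → |u i - t| + |b - t| ≤ |u i - b|) :
    ¬ ∑ i ∈ N, |u i - b| ≤ ∑ i ∈ N, |u i - t| := by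
  intro hle
  have hd : 0 < |b - t| := abs_pos.2 (sub_ne_zero.2 hbt)
  have hgood : p + 1 ≤ (N \ B).card := by
    have := Finset.le_card_sdiff B N
    omega
  have hbad : (N ∩ B).card ≤ p := (Finset.card_le_card Finset.inter_subset_right).trans hB
  have h₁ : ∑ i ∈ N \ B, (|u i - t| - |u i - b|) ≤ (N \ B).card • (-|b - t|) :=
    Finset.sum_le_card_nsmul _ _ _ fun i hi => by
      have := h i (Finset.mem_sdiff.1 hi).1 (Finset.mem_sdiff.1 hi).2
      linarith
  have h₂ : ∑ i ∈ N ∩ B, (|u i - t| - |u i - b|) ≤ (N ∩ B).card • |b - t| :=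
    Finset.sum_le_card_nsmul _ _ _ fun i _ => by
      have := abs_sub_le (u i) b t
      linarith
  have hsplit := Finset.sum_inter_add_sum_sdiff N B fun i => |u i - t| - |u i - b|
  rw [Finset.sum_sub_distrib (s := N)] at hsplit
  simp only [nsmul_eq_mul] at h₁ h₂
  have hgood' : (p : ℝ) + 1 ≤ (N \ B).card := by exact_mod_cast hgood
  have hbad' : ((N ∩ B).card : ℝ) ≤ p := by exact_mod_cast hbad
  nlinarith

lemma abs_sub_le_of_majority {ι : Type*} [DecidableEq ι] {N B : Finset ι} {p : ℕ}
    (hN : 2 * p + 1 ≤ N.card) (hB : B.card ≤ p) {u : ι → ℝ} {b c γ : ℝ}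
    (h : ∀ i ∈ N, i ∉ B → |u i - c| ≤ γ)
    (hmin : ∀ t, ∑ i ∈ N, |u i - b| ≤ ∑ i ∈ N, |u i - t|) : |b - c| ≤ γ := by
  rw [abs_le]
  constructor
  · by_contra! hlt
    refine not_sum_abs_sub_le_of_majority hN hB (t := c - γ) (by linarith : b < c - γ).ne
      (fun i hi hiB => ?_) (hmin _)
    have := abs_le.1 (h i hi hiB)
    rw [abs_of_nonneg (by linarith : 0 ≤ u i - (c - γ)), abs_of_neg (by linarith),
      abs_of_nonneg (by linarith : 0 ≤ u i - b)]
    linarith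
  · by_contra! hlt
    refine not_sum_abs_sub_le_of_majority hN hB (t := c + γ) (by linarith : c + γ < b).ne'
      (fun i hi hiB => ?_) (hmin _)
    have := abs_le.1 (h i hi hiB)
    rw [abs_of_nonpos (by linarith : u i - (c + γ) ≤ 0), abs_of_pos (by linarith),
      abs_of_nonpos (by linarith : u i - b ≤ 0)]
    linarith

/-- A separable `ℓ¹` minimizer minimizes the absolute deviations in each coordinate. -/
lemma sum_abs_sub_le_of_forall_sum_le {ι κ : Type*} [Fintype ι] [DecidableEq κ]
    (Q : ι → Finset κ) (u : ι → κ → ℝ) (b : κ → ℝ)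
    (hmin : ∀ z : κ → ℝ, ∑ i, ∑ j ∈ Q i, |u i j - b j| ≤ ∑ i, ∑ j ∈ Q i, |u i j - z j|)
    (j : κ) (t : ℝ) :
    ∑ i with j ∈ Q i, |u i j - b j| ≤ ∑ i with j ∈ Q i, |u i j - t| := by
  have hdiff : ∀ i, ∑ l ∈ Q i, |u i l - Function.update b j t l| - ∑ l ∈ Q i, |u i l - b l|
      = if j ∈ Q i then |u i j - t| - |u i j - b j| else 0 := by
    intro i
    rw [← Finset.sum_sub_distrib]
    split_ifs with hj
    · rw [Finset.sum_eq_single_of_mem j hj fun l _ hl => by simp [hl]]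
      simp
    · exact Finset.sum_eq_zero fun l hl => by
        simp [show l ≠ j by rintro rfl; exact hj hl]
  have h := sub_nonneg.2 (hmin (Function.update b j t))
  rw [← Finset.sum_sub_distrib, Finset.sum_congr rfl fun i _ => hdiff i, ← Finset.sum_filter,
    Finset.sum_sub_distrib] at h
  exact sub_nonneg.1 h

/-- Fusion of local estimates: the `ℓ¹` minimizer is coordinatewise `γ`-close to `x` as soon as
all but `p` of the local estimates are `γ`-close to `x`. -/
lemma abs_sub_le_of_norm1_minimizer {n m p : ℕ} (Q : Fin m → Finset (Fin n))
    (hcover : ∀ j : Fin n, 2 * p + 1 ≤ (Finset.univ.filter fun i => j ∈ Q i).card)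
    {B : Finset (Fin m)} (hB : B.card ≤ p) (u : ∀ i, Fin (Q i).card → ℝ) {b x : Fin n → ℝ}
    {γ : ℝ} (hgood : ∀ i ∉ B, vnorm2 (u i - (selMatrix (Q i) rfl).mulVec x) ≤ γ)
    (hmin : ∀ z : Fin n → ℝ, ∑ i, norm1 (u i - (selMatrix (Q i) rfl).mulVec b)
      ≤ ∑ i, norm1 (u i - (selMatrix (Q i) rfl).mulVec z)) (j : Fin n) : |b j - x j| ≤ γ := by
  simp only [norm1_sub_selMatrix_mulVec] at hmin
  refine abs_sub_le_of_majority (hcover j) hB (u := fun i => selExtend (Q i) (u i) j)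
    (fun i hi hiB => ?_) (sum_abs_sub_le_of_forall_sum_le Q (fun i => selExtend (Q i) (u i)) b
      hmin j)
  exact (abs_selExtend_sub_le (Q i) (u i) x (Finset.mem_filter.1 hi).2).trans (hgood i hiB)

/-- One step of a local observer contracts the error to `γ` in the absence of attacks. -/
lemma vnorm2_observer_step_le {n d : ℕ} {A : Matrix (Fin n) (Fin n) ℝ} {c : Fin n → ℝ}
    {H : Matrix (Fin d) (Fin n) ℝ} {At : Matrix (Fin d) (Fin d) ℝ} {ct l : Fin d → ℝ}
    (hA : At * H = H * A) (hc : Matrix.vecMul ct H = c) {γ Bw Bv R : ℝ} (hR : 0 < R)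
    (hgain : mat2Norm (At - Matrix.vecMulVec l ct) ≤ (γ - Bw - vnorm2 l * Bv) / R)
    {e : Fin d → ℝ} {x w : Fin n → ℝ} (he : vnorm2 (e - H.mulVec x) ≤ R)
    (hw : vnorm2 (H.mulVec w) ≤ Bw) {v : ℝ} (hv : |v| ≤ Bv) :
    vnorm2 ((At - Matrix.vecMulVec l ct).mulVec e + (c ⬝ᵥ x + v) • l
      - H.mulVec (A.mulVec x + w)) ≤ γ := by
  have herr : (At - Matrix.vecMulVec l ct).mulVec e + (c ⬝ᵥ x + v) • l
      - H.mulVec (A.mulVec x + w)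
      = (At - Matrix.vecMulVec l ct).mulVec (e - H.mulVec x) + (v • l - H.mulVec w) := by
    have h₁ : At.mulVec (H.mulVec x) = H.mulVec (A.mulVec x) := by
      rw [Matrix.mulVec_mulVec, Matrix.mulVec_mulVec, hA]
    have h₂ : (Matrix.vecMulVec l ct).mulVec (H.mulVec x) = (c ⬝ᵥ x) • l := by
      rw [← hc, ← Matrix.dotProduct_mulVec, Matrix.vecMulVec_mulVec]
      simp
    rw [Matrix.mulVec_sub _ e, Matrix.sub_mulVec _ _ (H.mulVec x), h₁, h₂, Matrix.mulVec_add,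
      add_smul]
    abel
  have hcontr : vnorm2 ((At - Matrix.vecMulVec l ct).mulVec (e - H.mulVec x))
      ≤ γ - Bw - vnorm2 l * Bv := by
    have hnorm : 0 ≤ mat2Norm (At - Matrix.vecMulVec l ct) := norm_nonneg _
    calc _ ≤ mat2Norm (At - Matrix.vecMulVec l ct) * vnorm2 (e - H.mulVec x) :=
          vnorm2_mulVec_le _ _
      _ ≤ mat2Norm (At - Matrix.vecMulVec l ct) * R := by gcongr
      _ ≤ _ := (le_div_iff₀ hR).1 hgain
  have hnoise : vnorm2 (v • l - H.mulVec w) ≤ vnorm2 l * Bv + Bw := by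
    have h := vnorm2_sub_le_add (v • l) 0 (H.mulVec w)
    rw [vnorm2_sub_comm 0, sub_zero, sub_zero, vnorm2_smul] at h
    nlinarith [mul_le_mul_of_nonneg_right hv (vnorm2_nonneg l)]
  rw [herr]
  linarith [vnorm2_add_le ((At - Matrix.vecMulVec l ct).mulVec (e - H.mulVec x))
    (v • l - H.mulVec w)]

/-- Theorem 6, eq. (29): under the structural
identities `Ã_i H_i = H_i A`, `C̃_i H_i = C_i`, the gain/threshold design inequalities,
the coverage condition `|{i : j ∈ Q_i}| ≥ 2p + 1`, bounded noises, `p`-sparse (possibly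
time-varying) attacks, and the estimation algorithm (local observers, `ℓ¹`-fusion
minimizer, detection-and-reset), every sensor `i` that is benign at time `k`
(`a_i(k) = 0`) does not trigger the detector at time `k + 1`:
`‖η_i(k+1) − H_i x̂(k+1)‖₂ ≤ (√n_i + 1) γ`. -/
theorem stmt16 {n m p : ℕ}
    (A : Matrix (Fin n) (Fin n) ℝ) (C : Matrix (Fin m) (Fin n) ℝ)
    (Q : Fin m → Finset (Fin n)) (hQne : ∀ i, (Q i).Nonempty)
    (Atil : ∀ i, Matrix (Fin (Q i).card) (Fin (Q i).card) ℝ)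
    (ctil : ∀ i, Fin (Q i).card → ℝ)
    (L : ∀ i, Fin (Q i).card → ℝ)
    (hAH : ∀ i, Atil i * selMatrix (Q i) rfl = selMatrix (Q i) rfl * A)
    (hCH : ∀ i, Matrix.vecMul (ctil i) (selMatrix (Q i) rfl) = C i)
    (γ Bw Bv : ℝ) (hγ : 0 < γ) (hBw : 0 ≤ Bw) (hBv : 0 ≤ Bv)
    (hgain1 : ∀ i, Bw + vnorm2 (L i) * Bv ≤ γ)
    (hgain2 : ∀ i, mat2Norm (Atil i - Matrix.vecMulVec (L i) (ctil i))
        ≤ (γ - Bw - vnorm2 (L i) * Bv) / ((2 * Real.sqrt (Q i).card + 1) * γ))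
    (hcover : ∀ j : Fin n, 2 * p + 1 ≤ (Finset.univ.filter fun i => j ∈ Q i).card)
    (x w : ℕ → Fin n → ℝ)
    (hx : ∀ k, x (k + 1) = A.mulVec (x k) + w k)
    (hw : ∀ k, vnorm2 (w k) ≤ Bw)
    (v a y : ℕ → Fin m → ℝ)
    (hv : ∀ k i, |v k i| ≤ Bv)
    (ha : ∀ k, (Finset.univ.filter fun i => a k i ≠ 0).card ≤ p)
    (hy : ∀ k i, y k i = C i ⬝ᵥ x k + v k i + a k i)
    (xhat : ℕ → Fin n → ℝ)
    (hxhat0 : ∀ j, |xhat 0 j - x 0 j| ≤ γ)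
    (η ηp : ∀ i : Fin m, ℕ → Fin (Q i).card → ℝ)
    (hηp0 : ∀ i, ηp i 0 = (selMatrix (Q i) rfl).mulVec (xhat 0))
    (hη : ∀ i k, η i (k + 1)
      = (Atil i - Matrix.vecMulVec (L i) (ctil i)).mulVec (ηp i k) + y k i • L i)
    (hmin : ∀ k, 1 ≤ k → ∀ z : Fin n → ℝ,
      ∑ i, norm1 (η i k - (selMatrix (Q i) rfl).mulVec (xhat k))
        ≤ ∑ i, norm1 (η i k - (selMatrix (Q i) rfl).mulVec z))
    (hreset : ∀ i k, 1 ≤ k →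
      ηp i k = if (Real.sqrt (Q i).card + 1) * γ
          < vnorm2 (η i k - (selMatrix (Q i) rfl).mulVec (xhat k))
        then (selMatrix (Q i) rfl).mulVec (xhat k) else η i k) :
    ∀ k (i : Fin m), a k i = 0 →
      vnorm2 (η i (k + 1) - (selMatrix (Q i) rfl).mulVec (xhat (k + 1)))
        ≤ (Real.sqrt (Q i).card + 1) * γ := by
  have hR : ∀ i, 0 < (2 * Real.sqrt (Q i).card + 1) * γ := fun i => by positivity
  have hbenign : ∀ k, (∀ i, vnorm2 (ηp i k - (selMatrix (Q i) rfl).mulVec (x k))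
      ≤ (2 * Real.sqrt (Q i).card + 1) * γ) → ∀ i, a k i = 0 →
      vnorm2 (η i (k + 1) - (selMatrix (Q i) rfl).mulVec (x (k + 1))) ≤ γ := by
    intro k hk i hi
    rw [hη, hy, hi, add_zero, hx]
    exact vnorm2_observer_step_le (hAH i) (hCH i) (hR i) (hgain2 i) (hk i)
      ((vnorm2_selMatrix_mulVec_le _ _).trans (hw k)) (hv k i)
  have hfusion : ∀ k, (∀ i, vnorm2 (ηp i k - (selMatrix (Q i) rfl).mulVec (x k))
      ≤ (2 * Real.sqrt (Q i).card + 1) * γ) → ∀ j, |xhat (k + 1) j - x (k + 1) j| ≤ γ := by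
    intro k hk
    exact abs_sub_le_of_norm1_minimizer Q hcover (ha k) (fun i => η i (k + 1))
      (fun i hi => hbenign k hk i (by simpa using hi)) (hmin (k + 1) (by omega))
  have hinv : ∀ k i, vnorm2 (ηp i k - (selMatrix (Q i) rfl).mulVec (x k))
      ≤ (2 * Real.sqrt (Q i).card + 1) * γ := by
    intro k
    induction k with
    | zero =>
      intro i
      rw [hηp0]
      have h := vnorm2_selMatrix_sub_le (Q i) hγ.le hxhat0
      nlinarith [Real.sqrt_nonneg (Q i).card]
    | succ k ih =>
      intro i
      have h := vnorm2_selMatrix_sub_le (Q i) hγ.le (hfusion k ih)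
      rw [hreset i (k + 1) (by omega)]
      split_ifs with hdet
      · nlinarith [Real.sqrt_nonneg (Q i).card]
      · have htri := vnorm2_sub_le_add (η i (k + 1)) ((selMatrix (Q i) rfl).mulVec (xhat (k + 1)))
          ((selMatrix (Q i) rfl).mulVec (x (k + 1)))
        linarith
  intro k i hi
  have h := vnorm2_selMatrix_sub_le (Q i) hγ.le (hfusion k (hinv k))
  rw [vnorm2_sub_comm] at h
  have htri := vnorm2_sub_le_add (η i (k + 1)) ((selMatrix (Q i) rfl).mulVec (x (k + 1)))
    ((selMatrix (Q i) rfl).mulVec (xhat (k + 1)))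
  linarith [hbenign k (hinv k) i hi]
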